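/- Let D ⊂ ℝ^m be a domain, S ⊂ D a nonempty compact set, and suppose v is nonnegative, subharmonic on D \ S, bounded by b there, and satisfies lim_{x→∂D} v(x) = 0 (i.e. for every point x of the boundary of D, limsup of v along D \ S tending to x is 0). Extend v by 0 on the complement of D. Then the extended function is nonnegative and subharmonic on ℝ^m \ S (in the one-point compactification, away from S), and vanishes outside D. -/

import Mathlib

open MeasureTheory Metric Filter
open scoped Classical

/-- A function is subharmonic on an open set `O ⊆ ℝ^m` if it is upper semicontinuous
there and satisfies the sub-mean-value inequality on closed balls contained in `O`. -/
def SubharmonicOn {m : ℕ} (f : EuclideanSpace ℝ (Fin m) → ℝ)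
    (O : Set (EuclideanSpace ℝ (Fin m))) : Prop :=
  UpperSemicontinuousOn f O ∧
    ∀ x ∈ O, ∀ r : ℝ, 0 < r → closedBall x r ⊆ O →
      f x ≤ ⨍ y in closedBall x r, f y

section RadialAverage

open scoped ENNReal

variable {E : Type*} [NormedAddCommGroup E] [InnerProductSpace ℝ E] [FiniteDimensional ℝ E]

instance compactSpace_unitary_continuousLinearMap : CompactSpace (unitary (E →L[ℝ] E)) := by
  refine (isCompact_iff_compactSpace (s := (unitary (E →L[ℝ] E) : Set (E →L[ℝ] E)))).1 ?_
  refine Metric.isCompact_of_isClosed_isBounded isClosed_unitary ?_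
  refine isBounded_closedBall (x := (0 : E →L[ℝ] E)) (r := 1) |>.subset fun U hU => ?_
  rw [mem_closedBall_zero_iff]
  refine U.opNorm_le_bound zero_le_one fun x => ?_
  rw [one_mul, U.norm_map_of_mem_unitary hU x]

/-- The average of a function over all rotations about the origin. -/
noncomputable def rotationAverage (F : E → ℝ≥0∞) (y : E) : ℝ≥0∞ :=
  ∫⁻ U : unitary (E →L[ℝ] E), F (((U⁻¹ : unitary (E →L[ℝ] E)) : E →L[ℝ] E) y)
    ∂Measure.haarMeasure ⊤

instance isProbabilityMeasure_haarMeasure_top :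
    IsProbabilityMeasure (Measure.haarMeasure (⊤ : TopologicalSpace.PositiveCompacts
      (unitary (E →L[ℝ] E)))) :=
  ⟨by simpa using Measure.haarMeasure_self (K₀ := (⊤ : TopologicalSpace.PositiveCompacts
      (unitary (E →L[ℝ] E))))⟩

theorem continuous_unitary_inv_apply :
    Continuous fun p : unitary (E →L[ℝ] E) × E =>
      ((p.1⁻¹ : unitary (E →L[ℝ] E)) : E →L[ℝ] E) p.2 :=
  (continuous_subtype_val.comp continuous_fst.inv).clm_apply continuous_snd

theorem rotationAverage_zero (F : E → ℝ≥0∞) : rotationAverage F 0 = F 0 := by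
  simp [rotationAverage]

theorem rotationAverage_eq_of_norm_eq (F : E → ℝ≥0∞) {y z : E} (h : ‖y‖ = ‖z‖) :
    rotationAverage F y = rotationAverage F z := by
  set V : unitary (E →L[ℝ] E) :=
    Unitary.linearIsometryEquiv.symm ((Submodule.span ℝ {y - z})ᗮ.reflection) with hV
  have hVy : (V : E →L[ℝ] E) y = z := by
    rw [hV, Unitary.coe_symm_linearIsometryEquiv_apply]
    exact Submodule.reflection_sub h
  have hVz : ((V⁻¹ : unitary (E →L[ℝ] E)) : E →L[ℝ] E) z = y := by
    rw [← hVy, ← mul_apply_eq_comp, ← Submonoid.coe_mul, inv_mul_cancel]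
    rfl
  unfold rotationAverage
  rw [← lintegral_mul_left_eq_self (μ := Measure.haarMeasure ⊤)
    (fun U : unitary (E →L[ℝ] E) => F (((U⁻¹ : unitary (E →L[ℝ] E)) : E →L[ℝ] E) z)) V]
  refine lintegral_congr fun U => ?_
  rw [mul_inv_rev, Submonoid.coe_mul, mul_apply_eq_comp, hVz]

theorem rotationAverage_le {F : E → ℝ≥0∞} {C : ℝ≥0∞} (hC : ∀ y, F y ≤ C) (y : E) :
    rotationAverage F y ≤ C :=
  (lintegral_mono fun _ => hC _).trans (by simp)

variable [MeasurableSpace E] [BorelSpace E]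

/-- Maximum principle for radial functions: a radial upper semicontinuous function satisfying
the sub-mean-value inequality on small balls is minimal at the centre. -/
theorem radial_submean_zero_le {G : E → ℝ≥0∞} (hG : UpperSemicontinuous G)
    (hfin : ∀ y, G y ≠ ∞) (hrad : ∀ y z, ‖y‖ = ‖z‖ → G y = G z) {R : ℝ}
    (hsub : ∀ z, ‖z‖ < R → ∃ ρ > 0, ∀ r, 0 < r → r ≤ ρ →
      volume (closedBall z r) * G z ≤ ∫⁻ w in closedBall z r, G w)
    {y : E} (hy : ‖y‖ ≤ R) : G 0 ≤ G y := by
  have hK : IsCompact (closedBall (0 : E) ‖y‖) := isCompact_closedBall _ _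
  obtain ⟨a, haK, ha⟩ := (hG.upperSemicontinuousOn _).exists_isMaxOn
    ⟨0, mem_closedBall_self (norm_nonneg y)⟩ hK
  have hL : IsCompact (closedBall (0 : E) ‖y‖ ∩ G ⁻¹' Set.Ici (G a)) :=
    hK.inter_right (hG.isClosed_preimage _)
  obtain ⟨z, ⟨hzK, hzM⟩, hz⟩ := hL.exists_isMaxOn ⟨a, haK, Set.mem_preimage.2 Set.self_mem_Ici⟩ continuous_norm.continuousOn
  have hmax : ∀ w, ‖w‖ ≤ ‖y‖ → G w ≤ G z := fun w hw =>
    (ha (mem_closedBall_zero_iff.2 hw)).trans hzM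
  rcases (mem_closedBall_zero_iff.1 hzK).eq_or_lt with hzy | hzy
  · rw [← hrad z y hzy]
    exact hmax 0 (by simp)
  exfalso
  have hlt : ∀ w, ‖w‖ ≤ ‖y‖ → ‖z‖ < ‖w‖ → G w < G z := by
    intro w hw hzw
    by_contra! h
    exact absurd (hz ⟨mem_closedBall_zero_iff.2 hw, hzM.trans h⟩) (not_le.2 hzw)
  obtain ⟨ρ, hρ, hsubz⟩ := hsub z (hzy.trans_le hy)
  set r := min ρ (‖y‖ - ‖z‖) with hr
  have hr0 : 0 < r := lt_min hρ (sub_pos.2 hzy)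
  have hball : ∀ w ∈ closedBall z r, ‖w‖ ≤ ‖y‖ := by
    intro w hw
    have h1 : ‖w - z‖ ≤ r := mem_closedBall_iff_norm.1 hw
    have h2 := norm_le_norm_add_norm_sub' w z
    have h3 : r ≤ ‖y‖ - ‖z‖ := min_le_right _ _
    linarith
  have hae : G =ᵐ[volume.restrict (closedBall z r)] fun _ => G z := by
    refine ae_eq_of_ae_le_of_lintegral_le ?_ ?_ aemeasurable_const ?_
    · filter_upwards [ae_restrict_mem measurableSet_closedBall] with w hw
      exact hmax w (hball w hw)
    · refine ne_top_of_le_ne_top (b := ∫⁻ _ in closedBall z r, G z) ?_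
        (setLIntegral_mono measurable_const fun w hw => hmax w (hball w hw))
      rw [setLIntegral_const]
      exact ENNReal.mul_ne_top (hfin z) measure_closedBall_lt_top.ne
    · rw [setLIntegral_const, mul_comm]
      exact hsubz r hr0 (min_le_left _ _)
  have hO : IsOpen (ball z r ∩ {w | ‖z‖ < ‖w‖}) :=
    isOpen_ball.inter (isOpen_lt continuous_const continuous_norm)
  have hnull : volume (ball z r ∩ {w | ‖z‖ < ‖w‖}) = 0 := by
    have := (ae_restrict_iff' measurableSet_closedBall).1 hae
    refine measure_mono_null ?_ this
    rintro w ⟨hw, hzw⟩ h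
    exact (hlt w (hball w (ball_subset_closedBall hw)) hzw).ne (h (ball_subset_closedBall hw))
  have hempty := (hO.measure_eq_zero_iff volume).1 hnull
  have hy0 : 0 < ‖y‖ := (norm_nonneg z).trans_lt hzy
  set e : E := (r / 2 / ‖y‖) • y with he
  have hen : ‖e‖ = r / 2 := by
    rw [he, norm_smul, Real.norm_of_nonneg (by positivity)]
    field_simp
  have h1 : ‖z + e‖ ≤ ‖z‖ := by
    by_contra! h
    have : z + e ∈ ball z r ∩ {w | ‖z‖ < ‖w‖} := ⟨by simp [hen, hr0], h⟩
    simp [hempty] at this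
  have h2 : ‖z - e‖ ≤ ‖z‖ := by
    by_contra! h
    have : z - e ∈ ball z r ∩ {w | ‖z‖ < ‖w‖} := ⟨by simp [hen, hr0], h⟩
    simp [hempty] at this
  have h3 := parallelogram_law_with_norm ℝ z e
  nlinarith [norm_nonneg (z + e), norm_nonneg (z - e), norm_nonneg z]

theorem UpperSemicontinuous.rotationAverage {F : E → ℝ≥0∞} (hF : UpperSemicontinuous F)
    {C : ℝ≥0∞} (hCtop : C ≠ ∞) (hC : ∀ y, F y ≤ C) :
    UpperSemicontinuous (rotationAverage F) := by
  intro y c hc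
  by_contra hcon
  obtain ⟨u, hu, huc⟩ := exists_seq_forall_of_frequently (not_eventually.1 hcon)
  have hmeas : ∀ y : E, Measurable fun U : unitary (E →L[ℝ] E) =>
      F (((U⁻¹ : unitary (E →L[ℝ] E)) : E →L[ℝ] E) y) := fun y =>
    hF.measurable.comp
      (continuous_unitary_inv_apply.comp (continuous_id.prodMk continuous_const)).measurable
  have h1 := limsup_lintegral_le (μ := Measure.haarMeasure (⊤ : TopologicalSpace.PositiveCompacts
      (unitary (E →L[ℝ] E)))) (fun _ => C) (fun n => hmeas (u n))
    (fun n => Eventually.of_forall fun U => hC _) (by simpa using hCtop)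
  have h2 : c ≤ limsup (fun n => _root_.rotationAverage F (u n)) atTop :=
    le_limsup_of_frequently_le (Eventually.of_forall fun n => not_lt.1 (huc n)).frequently
  refine absurd ((h2.trans h1).trans (lintegral_mono fun U => ?_)) (not_le.2 hc)
  have ht : Tendsto (fun n => ((U⁻¹ : unitary (E →L[ℝ] E)) : E →L[ℝ] E) (u n)) atTop
      (nhds (((U⁻¹ : unitary (E →L[ℝ] E)) : E →L[ℝ] E) y)) :=
    (((U⁻¹ : unitary (E →L[ℝ] E)) : E →L[ℝ] E).continuous.tendsto y).comp hu
  refine le_of_forall_gt_imp_ge_of_dense fun a ha => ?_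
  exact limsup_le_of_le (h := (ht.eventually (hF _ a ha)).mono fun n hn => hn.le)

theorem setLIntegral_rotationAverage {F : E → ℝ≥0∞} (hF : Measurable F) (z : E) (r : ℝ) :
    ∫⁻ y in closedBall z r, rotationAverage F y =
      ∫⁻ U : unitary (E →L[ℝ] E),
        (∫⁻ y in closedBall (((U⁻¹ : unitary (E →L[ℝ] E)) : E →L[ℝ] E) z) r, F y)
        ∂Measure.haarMeasure ⊤ := by
  unfold rotationAverage
  rw [lintegral_lintegral_swap]
  · refine lintegral_congr fun U => ?_
    set T := Unitary.linearIsometryEquiv U⁻¹ with hT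
    have := T.measurePreserving.setLIntegral_comp_preimage
      (measurableSet_closedBall (x := T z) (ε := r)) hF
    rw [T.preimage_closedBall, T.symm_apply_apply] at this
    exact this
  · exact ((hF.comp (continuous_unitary_inv_apply.measurable)).comp measurable_swap).aemeasurable

/-- An upper semicontinuous function satisfying the sub-mean-value inequality on balls whose
radius is small, uniformly on each sphere about the origin, satisfies it on a large ball. -/
theorem submean_closedBall_zero {F : E → ℝ≥0∞} (hF : UpperSemicontinuous F)
    {C : ℝ≥0∞} (hCtop : C ≠ ∞) (hC : ∀ y, F y ≤ C) {R : ℝ}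
    (hsub : ∀ t < R, ∃ ρ > 0, ∀ r, 0 < r → r ≤ ρ → ∀ z, ‖z‖ = t →
      volume (closedBall z r) * F z ≤ ∫⁻ w in closedBall z r, F w) :
    volume (closedBall (0 : E) R) * F 0 ≤ ∫⁻ y in closedBall (0 : E) R, F y := by
  have key : ∀ y ∈ closedBall (0 : E) R, F 0 ≤ rotationAverage F y := by
    intro y hy
    rw [← rotationAverage_zero F]
    refine radial_submean_zero_le (R := R) (hF.rotationAverage hCtop hC)
      (fun y => ne_top_of_le_ne_top hCtop (rotationAverage_le hC y))
      (fun y z h => rotationAverage_eq_of_norm_eq F h) ?_ (mem_closedBall_zero_iff.1 hy)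
    intro z hz
    obtain ⟨ρ, hρ, h⟩ := hsub ‖z‖ hz
    refine ⟨ρ, hρ, fun r hr hrρ => ?_⟩
    rw [setLIntegral_rotationAverage hF.measurable, rotationAverage,
      ← lintegral_const_mul' _ _ measure_closedBall_lt_top.ne]
    refine lintegral_mono fun U => ?_
    have := h r hr hrρ (((U⁻¹ : unitary (E →L[ℝ] E)) : E →L[ℝ] E) z) (Unitary.norm_map _ _)
    rwa [Measure.addHaar_closedBall_center, ← Measure.addHaar_closedBall_center volume z] at this
  calc volume (closedBall (0 : E) R) * F 0 = ∫⁻ _ in closedBall (0 : E) R, F 0 := by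
        rw [setLIntegral_const, mul_comm]
    _ ≤ ∫⁻ y in closedBall (0 : E) R, rotationAverage F y :=
        setLIntegral_mono' measurableSet_closedBall key
    _ = ∫⁻ y in closedBall (0 : E) R, F y := by
        rw [setLIntegral_rotationAverage hF.measurable]
        simp

/-- An upper semicontinuous function satisfying the sub-mean-value inequality on balls whose
radius is small, uniformly on each sphere about `x`, satisfies it on a large ball about `x`. -/
theorem submean_closedBall {F : E → ℝ≥0∞} (hF : UpperSemicontinuous F)
    {C : ℝ≥0∞} (hCtop : C ≠ ∞) (hC : ∀ y, F y ≤ C) {x : E} {R : ℝ}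
    (hsub : ∀ t < R, ∃ ρ > 0, ∀ r, 0 < r → r ≤ ρ → ∀ z, dist z x = t →
      volume (closedBall z r) * F z ≤ ∫⁻ w in closedBall z r, F w) :
    volume (closedBall x R) * F x ≤ ∫⁻ y in closedBall x R, F y := by
  have htrans : ∀ (z : E) (r : ℝ), ∫⁻ w in closedBall z r, F (x + w) =
      ∫⁻ w in closedBall (x + z) r, F w := by
    intro z r
    have := (measurePreserving_add_left volume x).setLIntegral_comp_preimage
      (measurableSet_closedBall (x := x + z) (ε := r)) hF.measurable
    rwa [preimage_add_closedBall, add_sub_cancel_left] at this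
  have h := submean_closedBall_zero (F := fun y => F (x + y)) (R := R)
    (hF.comp (continuous_const_add x)) hCtop (fun y => hC _) ?_
  · rwa [htrans, add_zero, ← Measure.addHaar_closedBall_center volume x] at h
  intro t ht
  obtain ⟨ρ, hρ, h⟩ := hsub t ht
  refine ⟨ρ, hρ, fun r hr hrρ z hz => ?_⟩
  have h2 := h r hr hrρ (x + z) (by simpa [dist_eq_norm] using hz)
  rwa [htrans, Measure.addHaar_closedBall_center, ← Measure.addHaar_closedBall_center volume (x + z)]

end RadialAverage

open scoped ENNReal in
/-- Sub-mean-value inequalities for real functions pass to the positive part of `g - δ`. -/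
theorem measure_mul_ofReal_sub_le_setLIntegral {α : Type*} [MeasurableSpace α] {μ : Measure α}
    {s : Set α} (hs : μ s ≠ ∞) {g : α → ℝ} (hg : IntegrableOn g s μ) {a : ℝ}
    (ha : a ≤ ⨍ y in s, g y ∂μ) (δ : ℝ) :
    μ s * ENNReal.ofReal (a - δ) ≤ ∫⁻ y in s, ENNReal.ofReal (g y - δ) ∂μ := by
  rcases eq_or_ne (μ s) 0 with h0 | h0
  · simp [h0]
  have hpos : 0 < μ.real s := ENNReal.toReal_pos h0 hs
  have hconst : IntegrableOn (fun _ => δ) s μ := integrableOn_const hs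
  have hint : IntegrableOn (fun y => g y - δ) s μ := hg.sub hconst
  have h1 : μ.real s * (a - δ) ≤ ∫ y in s, (g y - δ) ∂μ := by
    rw [integral_sub hg hconst, setIntegral_const, smul_eq_mul, mul_sub]
    rw [setAverage_eq, smul_eq_mul, inv_mul_eq_div, le_div_iff₀ hpos] at ha
    linarith
  have h2 : ∫ y in s, (g y - δ) ∂μ ≤ ∫ y in s, max (g y - δ) 0 ∂μ :=
    integral_mono hint hint.pos_part fun y => le_max_left _ _
  calc μ s * ENNReal.ofReal (a - δ) = ENNReal.ofReal (μ.real s * (a - δ)) := by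
        rw [ENNReal.ofReal_mul hpos.le, Measure.real, ENNReal.ofReal_toReal hs]
    _ ≤ ENNReal.ofReal (∫ y in s, max (g y - δ) 0 ∂μ) :=
        ENNReal.ofReal_le_ofReal (h1.trans h2)
    _ = ∫⁻ y in s, ENNReal.ofReal (g y - δ) ∂μ := by
        rw [ofReal_integral_eq_lintegral_ofReal hint.pos_part
          (Eventually.of_forall fun y => le_max_right _ _)]
        simp

/-- Restricting a nonnegative upper semicontinuous function to a closed subset of its open domain
and extending by zero gives an upper semicontinuous function. -/
theorem UpperSemicontinuousOn.indicator_of_isClosed {X : Type*} [TopologicalSpace X] {u : X → ℝ}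
    {O B : Set X} (hu : UpperSemicontinuousOn u O) (hO : IsOpen O) (hB : IsClosed B)
    (hBO : B ⊆ O) (hnn : ∀ z ∈ O, 0 ≤ u z) : UpperSemicontinuous (B.indicator u) := by
  intro z c hc
  by_cases hz : z ∈ B
  · rw [Set.indicator_of_mem hz] at hc
    have h := hu z (hBO hz) c hc
    rw [hO.nhdsWithin_eq (hBO hz)] at h
    filter_upwards [h] with w hw
    by_cases hwB : w ∈ B
    · simpa [hwB] using hw
    · simpa [hwB] using (hnn z (hBO hz)).trans_lt hc
  · rw [Set.indicator_of_notMem hz] at hc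
    filter_upwards [hB.isOpen_compl.mem_nhds hz] with w hw
    rwa [Set.indicator_of_notMem hw]

/-- The extension by zero of an upper semicontinuous function on `D \ S` with zero
boundary values on `frontier D` is upper semicontinuous off `S`. -/
theorem upperSemicontinuousOn_zero_extension {X : Type*} [TopologicalSpace X] {D S : Set X}
    (hD : IsOpen D) (hS : IsClosed S) {v : X → ℝ}
    (hv : UpperSemicontinuousOn v (D \ S))
    {b : ℝ} (hbd : ∀ x ∈ D \ S, v x ≤ b)
    (hlim : ∀ x ∈ frontier D, limsup v (nhdsWithin x (D \ S)) = 0) :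
    UpperSemicontinuousOn (fun x => if x ∈ D then v x else 0) Sᶜ := by
  intro x hx c hc
  refine mem_nhdsWithin_of_mem_nhds ?_
  by_cases hxD : x ∈ D
  · have hxDS : x ∈ D \ S := ⟨hxD, hx⟩
    have hc' : v x < c := by simpa [hxD] using hc
    have hopen : IsOpen (D \ S) := hD.sdiff hS
    have h := hv x hxDS c hc'
    rw [hopen.nhdsWithin_eq hxDS] at h
    filter_upwards [h, hD.mem_nhds hxD] with w hw hwD
    simpa [hwD] using hw
  have hc' : 0 < c := by simpa [hxD] using hc
  by_cases hxF : x ∈ closure D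
  · have hlt : limsup v (nhdsWithin x (D \ S)) < c := by
      rwa [hlim x (by rw [hD.frontier_eq]; exact ⟨hxF, hxD⟩)]
    have hbdd : (nhdsWithin x (D \ S)).IsBoundedUnder (· ≤ ·) v :=
      isBoundedUnder_of_eventually_le (a := b)
        (eventually_mem_nhdsWithin.mono fun w hw => hbd w hw)
    have h := eventually_nhdsWithin_iff.1 (eventually_lt_of_limsup_lt hlt hbdd)
    filter_upwards [h, hS.isOpen_compl.mem_nhds hx] with w hw hwS
    by_cases hwD : w ∈ D
    · simpa [hwD] using hw ⟨hwD, hwS⟩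
    · simpa [hwD] using hc'
  · filter_upwards [isClosed_closure.isOpen_compl.mem_nhds hxF] with w hw
    have hwD : w ∉ D := fun h => hw (subset_closure h)
    simpa [hwD] using hc'

/-- Gluing with zero: a bounded nonnegative upper semicontinuous function on an open set `O`,
subharmonic on an open subset `V` and vanishing on `O \ V`, is subharmonic on `O`. -/
theorem SubharmonicOn.of_eq_zero_outside {m : ℕ} {u : EuclideanSpace ℝ (Fin m) → ℝ}
    {O V : Set (EuclideanSpace ℝ (Fin m))} (hO : IsOpen O) (hV : IsOpen V)
    (husc : UpperSemicontinuousOn u O) (hnn : ∀ x ∈ O, 0 ≤ u x)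
    {b : ℝ} (hb : ∀ x ∈ O, u x ≤ b) (hzero : ∀ x ∈ O, x ∉ V → u x = 0)
    (hu : SubharmonicOn u V) : SubharmonicOn u O := by
  refine ⟨husc, fun x hx R hR hBO => ?_⟩
  set B := closedBall x R with hB
  set g := B.indicator u with hg
  have hgusc : UpperSemicontinuous g :=
    husc.indicator_of_isClosed hO isClosed_closedBall hBO hnn
  have hgB : ∀ y ∈ B, g y = u y := fun y hy => Set.indicator_of_mem hy u
  have hb0 : 0 ≤ b := (hnn x hx).trans (hb x hx)
  have hg0 : ∀ y, 0 ≤ g y := Set.indicator_nonneg fun y hy => hnn y (hBO hy)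
  have hgb : ∀ y, g y ≤ b := fun y => Set.indicator_apply_le' (fun hy => hb y (hBO hy)) fun _ => hb0
  have hgint : ∀ (z : EuclideanSpace ℝ (Fin m)) (r : ℝ), IntegrableOn g (closedBall z r) :=
    fun z r => IntegrableOn.of_bound measure_closedBall_lt_top
      hgusc.measurable.aestronglyMeasurable b
      (Eventually.of_forall fun y => by rw [Real.norm_of_nonneg (hg0 y)]; exact hgb y)
  have hmem : x ∈ B := mem_closedBall_self hR.le
  have key : ∀ δ > 0, volume B * ENNReal.ofReal (g x - δ) ≤
      ∫⁻ y in B, ENNReal.ofReal (g y - δ) := by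
    intro δ hδ
    have hmono : Monotone fun t : ℝ => ENNReal.ofReal (t - δ) := fun s t h =>
      ENNReal.ofReal_le_ofReal (by linarith)
    have hcont : Continuous fun t : ℝ => ENNReal.ofReal (t - δ) :=
      ENNReal.continuous_ofReal.comp (continuous_sub_right δ)
    refine submean_closedBall (F := fun y => ENNReal.ofReal (g y - δ))
      (hcont.comp_upperSemicontinuous hgusc hmono) (C := ENNReal.ofReal (b - δ))
      ENNReal.ofReal_ne_top (fun y => hmono (hgb y)) ?_
    have hK : IsCompact (B ∩ g ⁻¹' Set.Ici δ) :=
      (isCompact_closedBall x R).inter_right (hgusc.isClosed_preimage δ)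
    have hKV : B ∩ g ⁻¹' Set.Ici δ ⊆ V := by
      rintro y ⟨hyB, hy⟩
      by_contra hyV
      have h0 : g y = 0 := (hgB y hyB).trans (hzero y (hBO hyB) hyV)
      have : δ ≤ g y := hy
      linarith
    obtain ⟨ρ, hρ, hρV⟩ := hK.exists_cthickening_subset_open hV hKV
    intro t ht
    refine ⟨min ρ (R - t), lt_min hρ (sub_pos.2 ht), fun r hr hrρ z hz => ?_⟩
    rcases lt_or_ge (g z) δ with hzδ | hzδ
    · simp [ENNReal.ofReal_of_nonpos (sub_nonpos.2 hzδ.le)]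
    have hzB : z ∈ B := by rw [hB, mem_closedBall, hz]; exact ht.le
    have hrB : closedBall z r ⊆ B :=
      closedBall_subset_closedBall' (by linarith [hrρ.trans (min_le_right _ _)])
    have hrV : closedBall z r ⊆ V :=
      ((closedBall_subset_cthickening (show z ∈ B ∩ g ⁻¹' Set.Ici δ from ⟨hzB, hzδ⟩) r).trans
        (cthickening_mono (hrρ.trans (min_le_left _ _)) _)).trans hρV
    refine measure_mul_ofReal_sub_le_setLIntegral measure_closedBall_lt_top.ne (hgint z r) ?_ δ
    rw [hgB z hzB, setAverage_congr_fun measurableSet_closedBall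
      (Eventually.of_forall fun y hy => hgB y (hrB hy))]
    exact hu.2 z (hrV (mem_closedBall_self hr.le)) r hr hrV
  have hvol : 0 < volume.real B :=
    ENNReal.toReal_pos (measure_closedBall_pos volume x hR).ne' measure_closedBall_lt_top.ne
  rw [← hgB x hmem, ← setAverage_congr_fun measurableSet_closedBall (Eventually.of_forall hgB)]
  refine le_of_forall_pos_sub_le fun δ hδ => ?_
  have h1 : ENNReal.ofReal (volume.real B * (g x - δ)) ≤ ENNReal.ofReal (∫ y in B, g y) := by
    rw [ENNReal.ofReal_mul hvol.le, Measure.real, ENNReal.ofReal_toReal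
      measure_closedBall_lt_top.ne, ofReal_integral_eq_lintegral_ofReal (hgint x R)
      (Eventually.of_forall hg0)]
    exact (key δ hδ).trans (lintegral_mono fun y => ENNReal.ofReal_le_ofReal (by linarith))
  rw [ENNReal.ofReal_le_ofReal_iff (integral_nonneg hg0)] at h1
  rwa [setAverage_eq, smul_eq_mul, inv_mul_eq_div, le_div_iff₀ hvol, mul_comm]

/-- Zero-extension of a bounded test function: if `v ≥ 0` is subharmonic on `D \ S`,
bounded by `b`, and tends to `0` at every boundary point of the domain `D`, then its
extension by `0` outside `D` is nonnegative and subharmonic on `ℝ^m \ S` and vanishes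
outside `D`. -/
theorem test_function_zero_extension {m : ℕ} (D : Set (EuclideanSpace ℝ (Fin m)))
    (hDopen : IsOpen D) (hDconn : IsConnected D)
    (S : Set (EuclideanSpace ℝ (Fin m))) (hS : IsCompact S) (hSne : S.Nonempty)
    (hSD : S ⊆ D) (v : EuclideanSpace ℝ (Fin m) → ℝ)
    (hv : SubharmonicOn v (D \ S)) (hpos : ∀ x ∈ D \ S, 0 ≤ v x)
    (b : ℝ) (hbd : ∀ x ∈ D \ S, v x ≤ b)
    (hlim : ∀ x ∈ frontier D, limsup v (nhdsWithin x (D \ S)) = 0) :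
    SubharmonicOn (fun x => if x ∈ D then v x else 0) Sᶜ ∧
      (∀ x ∈ Sᶜ, 0 ≤ if x ∈ D then v x else 0) ∧
      ∀ x ∉ D, (if x ∈ D then v x else 0) = 0 := by
  have hSc : IsClosed S := hS.isClosed
  have hnn : ∀ x ∈ Sᶜ, 0 ≤ if x ∈ D then v x else 0 := by
    intro x hx
    split_ifs with hxD
    exacts [hpos x ⟨hxD, hx⟩, le_rfl]
  refine ⟨?_, hnn, fun x hx => if_neg hx⟩
  have heq : ∀ x ∈ D \ S, (if x ∈ D then v x else 0) = v x := fun x hx => if_pos hx.1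
  have husc := upperSemicontinuousOn_zero_extension hDopen hSc hv.1 hbd hlim
  refine SubharmonicOn.of_eq_zero_outside (V := D \ S) (b := max b 0) hSc.isOpen_compl
    (hDopen.sdiff hSc) husc hnn ?_ ?_ ⟨husc.mono fun x hx => hx.2, fun x hx r hr hxr => ?_⟩
  · intro x hx
    split_ifs with hxD
    exacts [(hbd x ⟨hxD, hx⟩).trans (le_max_left _ _), le_max_right _ _]
  · exact fun x hx hxV => if_neg fun hxD => hxV ⟨hxD, hx⟩
  · beta_reduce
    rw [heq x hx, setAverage_congr_fun measurableSet_closedBall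
      (Eventually.of_forall fun y hy => heq y (hxr hy))]
    exact hv.2 x hx r hr hxr
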